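/- arXiv:2508.09492 — 2 statements merged into one kernel-verified Lean document; each statement's English description precedes it below -/
import Mathlib

section
/- For every subset A ⊆ N and all i,j ∈ A, the identity Σ_{l∈A} m_{il}^{¬A} · m_{lj} = 2·m_{ij} − 1_{i=j} holds in ℤ[[x]]; equivalently, in matrix form M_{AA}^{¬A} · M_{AA} = 2·M_{AA} − I, i.e. M_{AA}^{¬A} = 2I − (M_{AA})^{-1} where M_{AA} is invertible over the matrices with entries in ℤ[[x]]. -/
/-- The number of length-`t` walks from `i` to `j` in the graph with 0-1 adjacency
matrix `G`. -/
def walkCount {n : ℕ} (G : Matrix (Fin n) (Fin n) ℤ) (i j : Fin n) (t : ℕ) : ℕ :=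
  (Finset.univ.filter fun w : Fin (t + 1) → Fin n =>
    w 0 = i ∧ w (Fin.last t) = j ∧
      ∀ k : Fin t, G (w k.castSucc) (w k.succ) = 1).card

/-- The number of length-`t` walks from `i` to `j` none of whose intermediate nodes
lies in `A`. -/
def walkCountAvoid {n : ℕ} (G : Matrix (Fin n) (Fin n) ℤ) (A : Finset (Fin n))
    (i j : Fin n) (t : ℕ) : ℕ :=
  (Finset.univ.filter fun w : Fin (t + 1) → Fin n =>
    w 0 = i ∧ w (Fin.last t) = j ∧
      (∀ k : Fin t, G (w k.castSucc) (w k.succ) = 1) ∧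
      ∀ k : Fin (t + 1), k ≠ 0 → k ≠ Fin.last t → w k ∉ A).card

/-- `m_{ij}`. -/
noncomputable def mSer {n : ℕ} (G : Matrix (Fin n) (Fin n) ℤ) (i j : Fin n) :
    PowerSeries ℤ :=
  PowerSeries.mk fun t => (walkCount G i j t : ℤ)

/-- `m_{ij}^{¬A}`. -/
noncomputable def mAvoid {n : ℕ} (G : Matrix (Fin n) (Fin n) ℤ) (A : Finset (Fin n))
    (i j : Fin n) : PowerSeries ℤ :=
  PowerSeries.mk fun t => (walkCountAvoid G A i j t : ℤ)

/-- The submatrix `M_{AB}` of the walk generating matrix. -/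
noncomputable def Msub {n : ℕ} (G : Matrix (Fin n) (Fin n) ℤ) (A B : Finset (Fin n)) :
    Matrix ↥A ↥B (PowerSeries ℤ) :=
  Matrix.of fun a b => mSer G a b

/-- The submatrix `M_{AB}^{¬S}` of the `S`-avoiding walk generating matrix. -/
noncomputable def MsubAvoid {n : ℕ} (G : Matrix (Fin n) (Fin n) ℤ)
    (S A B : Finset (Fin n)) : Matrix ↥A ↥B (PowerSeries ℤ) :=
  Matrix.of fun a b => mAvoid G S a b

/-- First-step decomposition of the walks avoiding `A`. -/
theorem walkCountAvoid_succ {n : ℕ} (G : Matrix (Fin n) (Fin n) ℤ) (A : Finset (Fin n))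
    (i j : Fin n) (t : ℕ) :
    walkCountAvoid G A i j (t + 1) =
      ∑ k, if G i k = 1 ∧ (t = 0 ∨ k ∉ A) then walkCountAvoid G A k j t else 0 := by
  have avoid_iff (w : Fin (t + 1) → Fin n) (a : Fin n) :
      (∀ k : Fin (t + 2), k ≠ 0 → k ≠ Fin.last (t + 1) →
        (Fin.cons a w : Fin (t + 2) → Fin n) k ∉ A) ↔
      (t = 0 ∨ w 0 ∉ A) ∧ ∀ k : Fin (t + 1), k ≠ 0 → k ≠ Fin.last t → w k ∉ A := by
    rw [Fin.forall_fin_succ]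
    simp only [ne_eq, not_true_eq_false, false_imp_iff, true_and, Fin.succ_ne_zero,
      not_false_eq_true, true_imp_iff, Fin.cons_succ, ← Fin.succ_last, Fin.succ_inj]
    rw [Fin.forall_fin_succ]
    have hlast : (0 : Fin (t + 1)) = Fin.last t ↔ t = 0 := by
      rw [Fin.ext_iff]; simp [eq_comm]
    rw [hlast, Fin.forall_fin_succ (P := fun k => ¬k = 0 → ¬k = Fin.last t → w k ∉ A)]
    simp only [not_true_eq_false, false_imp_iff, true_and, Fin.succ_ne_zero,
      not_false_eq_true, true_imp_iff]
    tauto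
  have links_iff (w : Fin (t + 1) → Fin n) (a : Fin n) :
      (∀ k : Fin (t + 1), G ((Fin.cons a w : Fin (t + 2) → Fin n) k.castSucc)
        ((Fin.cons a w : Fin (t + 2) → Fin n) k.succ) = 1) ↔
      G a (w 0) = 1 ∧ ∀ k : Fin t, G (w k.castSucc) (w k.succ) = 1 := by
    rw [Fin.forall_fin_succ]
    simp only [Fin.castSucc_zero, Fin.cons_zero, Fin.cons_succ, ← Fin.succ_castSucc]
  have last_eq (w : Fin (t + 1) → Fin n) (a : Fin n) :
      (Fin.cons a w : Fin (t + 2) → Fin n) (Fin.last (t + 1)) = w (Fin.last t) := by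
    rw [← Fin.succ_last, Fin.cons_succ]
  have walks_card : walkCountAvoid G A i j (t + 1) = ∑ w : Fin (t + 1) → Fin n, ∑ a,
      if a = i ∧ w (Fin.last t) = j ∧
        (G a (w 0) = 1 ∧ ∀ k : Fin t, G (w k.castSucc) (w k.succ) = 1) ∧
        (t = 0 ∨ w 0 ∉ A) ∧ ∀ k : Fin (t + 1), k ≠ 0 → k ≠ Fin.last t → w k ∉ A
      then 1 else 0 := by
    rw [walkCountAvoid, Finset.card_filter, ← (Fin.consEquiv fun _ => Fin n).sum_comp,
      Fintype.sum_prod_type, Finset.sum_comm]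
    refine Finset.sum_congr rfl fun w _ => Finset.sum_congr rfl fun a _ => ?_
    refine if_congr ?_ rfl rfl
    rw [← avoid_iff w a, ← links_iff w a, ← last_eq w a]
    rfl
  rw [walks_card]
  simp only [walkCountAvoid, Finset.card_filter, Finset.ite_sum_zero, ← ite_and]
  rw [Finset.sum_comm (s := Finset.univ (α := Fin n))]
  refine Finset.sum_congr rfl fun w _ => ?_
  rw [Finset.sum_eq_single i (fun a _ h => if_neg fun H => h H.1) (by simp),
    Finset.sum_eq_single (w 0) (fun a _ h => if_neg fun H => h H.2.1.symm) (by simp)]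
  congr 1
  simp only [true_and, eq_iff_iff]
  tauto

theorem walkCountAvoid_zero {n : ℕ} (G : Matrix (Fin n) (Fin n) ℤ) (A : Finset (Fin n))
    (i j : Fin n) : walkCountAvoid G A i j 0 = if i = j then 1 else 0 := by
  rw [walkCountAvoid, Finset.card_filter, ← (Equiv.funUnique (Fin 1) (Fin n)).symm.sum_comp]
  rw [Finset.sum_eq_single i]
  · congr 1
    simp [Fin.forall_fin_one]
  · intro a _ h
    exact if_neg fun H => h H.1
  · simp

theorem walkCountAvoid_empty {n : ℕ} (G : Matrix (Fin n) (Fin n) ℤ) (i j : Fin n) (t : ℕ) :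
    walkCountAvoid G ∅ i j t = walkCount G i j t := by
  simp [walkCountAvoid, walkCount]

theorem mAvoid_empty {n : ℕ} (G : Matrix (Fin n) (Fin n) ℤ) (i j : Fin n) :
    mAvoid G ∅ i j = mSer G i j := by
  simp [mAvoid, mSer, walkCountAvoid_empty]

/-- The generating series of the nontrivial `A`-avoiding walks satisfies a linear system. -/
theorem mAvoid_sub_one {n : ℕ} (G : Matrix (Fin n) (Fin n) ℤ)
    (hG : ∀ i j, G i j = 0 ∨ G i j = 1) (A : Finset (Fin n)) (i j : Fin n) :
    mAvoid G A i j - (if i = j then 1 else 0) =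
      PowerSeries.X * (PowerSeries.C (G i j) +
        ∑ k ∈ Aᶜ, PowerSeries.C (G i k) * (mAvoid G A k j - if k = j then 1 else 0)) := by
  have coeff_delta (k : Fin n) (t : ℕ) :
      PowerSeries.coeff t (if k = j then 1 else 0 : PowerSeries ℤ) =
        if t = 0 then (if k = j then 1 else 0) else 0 := by
    split_ifs <;> simp_all [PowerSeries.coeff_one]
  have indicator_mul (k : Fin n) (c : ℤ) : (if G i k = 1 then c else 0) = G i k * c := by
    rcases hG i k with h | h <;> simp [h]
  ext (_ | t)
  · simp only [map_sub, coeff_delta, PowerSeries.coeff_zero_X_mul, mAvoid, PowerSeries.coeff_mk,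
      walkCountAvoid_zero]
    simp
  · rw [PowerSeries.coeff_succ_X_mul]
    simp only [map_sub, map_add, map_sum, PowerSeries.coeff_C_mul, coeff_delta, mAvoid,
      PowerSeries.coeff_mk, walkCountAvoid_succ, Nat.cast_sum, Nat.cast_ite, Nat.cast_zero,
      Nat.add_eq_zero_iff, one_ne_zero, and_false, if_false, sub_zero, PowerSeries.coeff_C]
    rcases t with _ | t
    · simp [walkCountAvoid_zero, indicator_mul]
    · simp only [Nat.add_eq_zero_iff, one_ne_zero, and_false, if_false, sub_zero, false_or,
        zero_add]
      rw [← Finset.sum_subset (Finset.subset_univ Aᶜ)]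
      · refine Finset.sum_congr rfl fun k hk => ?_
        rw [← indicator_mul]
        simp [Finset.mem_compl.1 hk]
      · intro k _ hk
        simp_all

theorem mSer_sub_one {n : ℕ} (G : Matrix (Fin n) (Fin n) ℤ)
    (hG : ∀ i j, G i j = 0 ∨ G i j = 1) (i j : Fin n) :
    mSer G i j - (if i = j then 1 else 0) =
      PowerSeries.X * ∑ k, PowerSeries.C (G i k) * mSer G k j := by
  have h := mAvoid_sub_one G hG ∅ i j
  simp only [mAvoid_empty, Finset.compl_empty, mul_sub, Finset.sum_sub_distrib] at h
  rw [h]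
  simp

/-- A linear system `D = X • H D` of power series has only the zero solution. -/
theorem eq_zero_of_eq_X_mul_sum {ι R : Type*} [CommRing R] (s : Finset ι)
    (H : ι → ι → PowerSeries R) (D : ι → PowerSeries R)
    (h : ∀ i, D i = PowerSeries.X * ∑ k ∈ s, H i k * D k) (i : ι) : D i = 0 := by
  have dvd (t : ℕ) : ∀ i, PowerSeries.X ^ t ∣ D i := by
    induction t with
    | zero => simp
    | succ t ih =>
      intro i
      rw [h i, pow_succ']
      exact mul_dvd_mul_left _ (Finset.dvd_sum fun k _ => (ih k).mul_left _)
  ext t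
  exact PowerSeries.X_pow_dvd_iff.1 (dvd (t + 1) i) t t.lt_succ_self

/-- Every nontrivial walk ending in `A` splits uniquely at its first return to `A`. -/
theorem sum_mAvoid_sub_one_mul {n : ℕ} (G : Matrix (Fin n) (Fin n) ℤ)
    (hG : ∀ i j, G i j = 0 ∨ G i j = 1) (A : Finset (Fin n)) (i j : Fin n) (hj : j ∈ A) :
    ∑ l ∈ A, (mAvoid G A i l - if i = l then 1 else 0) * mSer G l j =
      mSer G i j - if i = j then 1 else 0 := by
  rw [← sub_eq_zero]
  refine eq_zero_of_eq_X_mul_sum Aᶜ (fun i k => PowerSeries.C (G i k))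
    (fun i => ∑ l ∈ A, (mAvoid G A i l - if i = l then 1 else 0) * mSer G l j -
      (mSer G i j - if i = j then 1 else 0)) (fun i => ?_) i
  have hdelta : ∀ k ∈ Aᶜ, (if k = j then 1 else 0 : PowerSeries ℤ) = 0 := fun k hk =>
    if_neg (ne_of_mem_of_not_mem hj (Finset.mem_compl.1 hk)).symm
  have hrhs : ∑ k ∈ Aᶜ, PowerSeries.C (G i k) *
        (∑ l ∈ A, (mAvoid G A k l - if k = l then 1 else 0) * mSer G l j -
          (mSer G k j - if k = j then 1 else 0)) =
      ∑ l ∈ A, (∑ k ∈ Aᶜ, PowerSeries.C (G i k) *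
        (mAvoid G A k l - if k = l then 1 else 0)) * mSer G l j -
      ∑ k ∈ Aᶜ, PowerSeries.C (G i k) * mSer G k j := by
    simp only [Finset.sum_mul]
    rw [Finset.sum_comm, ← Finset.sum_sub_distrib]
    refine Finset.sum_congr rfl fun k hk => ?_
    rw [hdelta k hk, sub_zero, mul_sub, Finset.mul_sum]
    simp only [mul_assoc]
  simp only [hrhs, mSer_sub_one G hG i j, ← Finset.sum_add_sum_compl A]
  simp only [mAvoid_sub_one G hG A i, mul_assoc, add_mul, ← Finset.mul_sum,
    Finset.sum_add_distrib]
  ring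

theorem stmt5 {n : ℕ} (hn : 0 < n) (G : Matrix (Fin n) (Fin n) ℤ)
    (hG : ∀ i j, G i j = 0 ∨ G i j = 1) (hdiag : ∀ i, G i i = 0)
    (A : Finset (Fin n)) :
    (∀ i ∈ A, ∀ j ∈ A, ∑ l ∈ A, mAvoid G A i l * mSer G l j
        = 2 * mSer G i j - if i = j then 1 else 0) ∧
    IsUnit (Msub G A A) ∧
    MsubAvoid G A A A = 2 • (1 : Matrix ↥A ↥A (PowerSeries ℤ)) - (Msub G A A)⁻¹ := by
  have key : ∀ i ∈ A, ∀ j ∈ A, ∑ l ∈ A, mAvoid G A i l * mSer G l j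
      = 2 * mSer G i j - if i = j then 1 else 0 := by
    intro i hi j hj
    have h := sum_mAvoid_sub_one_mul G hG A i j hj
    simp only [sub_mul, Finset.sum_sub_distrib, ite_mul, one_mul, zero_mul, Finset.sum_ite_eq,
      hi, if_true] at h
    linear_combination h
  have hmul : MsubAvoid G A A A * Msub G A A = 2 • Msub G A A - 1 := by
    ext1 a b
    have h := key a a.2 b b.2
    rw [← Finset.sum_coe_sort] at h
    simp only [Matrix.mul_apply, MsubAvoid, Msub, Matrix.of_apply, Matrix.sub_apply,
      Matrix.smul_apply, Matrix.one_apply, Subtype.ext_iff]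
    rw [h, nsmul_eq_mul, Nat.cast_ofNat]
  have hinv : (2 • (1 : Matrix ↥A ↥A (PowerSeries ℤ)) - MsubAvoid G A A A) * Msub G A A = 1 := by
    rw [sub_mul, hmul, smul_mul_assoc, one_mul, sub_sub_cancel]
  refine ⟨key, IsUnit.of_mul_eq_one_right _ hinv, ?_⟩
  rw [Matrix.inv_eq_left_inv hinv, sub_sub_cancel]
end

section
/- For every subset A ⊆ N, the submatrix M_{AA} is invertible over the matrices with entries in ℤ[[x]], and the matrix identity M_{A^C A^C}^{¬A} = M_{A^C A^C} − M_{A^C A}·(M_{AA})^{-1}·M_{A A^C} holds; equivalently, for all i,j ∉ A, m_{ij} − m_{ij}^{¬A} = (M_{A^C A}(M_{AA})^{-1}M_{A A^C})_{ij}. -/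
open PowerSeries in
/-- The matrix `1 - x G` over `ℤ[[x]]`. -/
noncomputable def oneSubX {n : ℕ} (G : Matrix (Fin n) (Fin n) ℤ) :
    Matrix (Fin n) (Fin n) (PowerSeries ℤ) :=
  1 - Matrix.of fun i j => (X : PowerSeries ℤ) * C (G i j)

theorem walkCount_zero {n : ℕ} (G : Matrix (Fin n) (Fin n) ℤ) (i j : Fin n) :
    walkCount G i j 0 = if i = j then 1 else 0 := by
  unfold walkCount
  rw [Finset.card_filter, ← (Equiv.funUnique (Fin 1) (Fin n)).symm.sum_comp]
  simp [ite_and]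

theorem walkCount_succ {n : ℕ} {G : Matrix (Fin n) (Fin n) ℤ}
    (hG : ∀ i j, G i j = 0 ∨ G i j = 1) (i j : Fin n) (t : ℕ) :
    (walkCount G i j (t + 1) : ℤ) = ∑ k, G i k * (walkCount G k j t : ℤ) := by
  unfold walkCount
  simp only [Finset.card_filter]
  rw [← (Fin.consEquiv fun _ : Fin (t + 2) => Fin n).sum_comp, Fintype.sum_prod_type]
  push_cast
  simp only [Finset.mul_sum]
  rw [Finset.sum_comm, Finset.sum_comm (s := Finset.univ (α := Fin n))]
  refine Finset.sum_congr rfl fun w _ => ?_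
  rw [Finset.sum_eq_single_of_mem i (Finset.mem_univ _),
    Finset.sum_eq_single_of_mem (w 0) (Finset.mem_univ _)]
  · rcases hG i (w 0) with h | h <;>
      simp [Fin.consEquiv, Fin.forall_fin_succ, ← Fin.succ_last, h]
  · intro k _ hk
    simp [hk.symm]
  · intro k _ hk
    simp [Fin.consEquiv, hk]

theorem oneSubX_mul_mSer {n : ℕ} {G : Matrix (Fin n) (Fin n) ℤ}
    (hG : ∀ i j, G i j = 0 ∨ G i j = 1) :
    oneSubX G * Matrix.of (mSer G) = 1 := by
  unfold oneSubX
  rw [sub_mul, one_mul, sub_eq_iff_eq_add]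
  ext i j t
  cases t with
  | zero =>
    simp [Matrix.mul_apply, mSer, walkCount_zero, Matrix.one_apply, mul_assoc]
  | succ t =>
    simp [Matrix.mul_apply, mSer, walkCount_succ hG, Matrix.one_apply, mul_assoc,
      PowerSeries.coeff_succ_X_mul, -eq_intCast]
    split_ifs <;> simp [PowerSeries.coeff_one]

/-- The graph obtained from `G` by deleting all links at nodes of `A`. -/
def deleteLinks {n : ℕ} (G : Matrix (Fin n) (Fin n) ℤ) (A : Finset (Fin n)) :
    Matrix (Fin n) (Fin n) ℤ :=
  Matrix.of fun i j => if i ∈ A ∨ j ∈ A then 0 else G i j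

theorem deleteLinks_eq_one {n : ℕ} {G : Matrix (Fin n) (Fin n) ℤ} {A : Finset (Fin n)}
    {i j : Fin n} : deleteLinks G A i j = 1 ↔ G i j = 1 ∧ i ∉ A ∧ j ∉ A := by
  by_cases hi : i ∈ A <;> by_cases hj : j ∈ A <;> simp [deleteLinks, hi, hj]

theorem walkCountAvoid_eq {n : ℕ} (G : Matrix (Fin n) (Fin n) ℤ) {A : Finset (Fin n)}
    {i j : Fin n} (hi : i ∉ A) (hj : j ∉ A) (t : ℕ) :
    walkCountAvoid G A i j t = walkCount (deleteLinks G A) i j t := by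
  unfold walkCountAvoid walkCount
  congr 1
  refine Finset.filter_congr fun w _ => ?_
  simp only [deleteLinks_eq_one]
  constructor
  · rintro ⟨h0, hl, hw, hA⟩
    have hmem : ∀ k, w k ∉ A := fun k => by
      by_cases hk0 : k = 0
      · rwa [hk0, h0]
      by_cases hkl : k = Fin.last t
      · rwa [hkl, hl]
      exact hA k hk0 hkl
    exact ⟨h0, hl, fun k => ⟨hw k, hmem _, hmem _⟩⟩
  · rintro ⟨h0, hl, hw⟩
    refine ⟨h0, hl, fun k => (hw k).1, fun k _ hkl => ?_⟩
    obtain ⟨k, rfl⟩ := Fin.exists_castSucc_eq.2 hkl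
    exact (hw k).2.1

theorem sum_coe_add_sum_compl {n : ℕ} {R : Type*} [AddCommMonoid R] (A : Finset (Fin n))
    (f : Fin n → R) : ∑ a : ↥A, f a + ∑ a : ↥Aᶜ, f a = ∑ a, f a := by
  rw [Finset.sum_coe_sort A f, Finset.sum_coe_sort Aᶜ f, Finset.sum_add_sum_compl]

/-- Block multiplication along the partition of the index set into `A` and `Aᶜ`. -/
theorem submatrix_mul_eq_add {n : ℕ} {R l m : Type*} [NonUnitalNonAssocSemiring R]
    (P Q : Matrix (Fin n) (Fin n) R) (A : Finset (Fin n)) (f : l → Fin n) (g : m → Fin n) :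
    (P * Q).submatrix f g =
      P.submatrix f (Subtype.val : ↥A → Fin n) *
        Q.submatrix (Subtype.val : ↥A → Fin n) g +
      P.submatrix f (Subtype.val : ↥Aᶜ → Fin n) *
        Q.submatrix (Subtype.val : ↥Aᶜ → Fin n) g := by
  ext i j
  simp only [Matrix.submatrix_apply, Matrix.mul_apply, Matrix.add_apply]
  exact (sum_coe_add_sum_compl A fun k => P (f i) k * Q k (g j)).symm

/-- If `(p q; r s)` is inverse to `(a b; c d)` and `e` is inverse to `d`, then `p` is invertible
and `e` is the Schur complement of `p`. -/
theorem schur_complement_of_inverse {R l m : Type*} [CommRing R] [Fintype l] [Fintype m]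
    [DecidableEq l] [DecidableEq m] {p a : Matrix l l R} {q b : Matrix l m R}
    {r c : Matrix m l R} {s d e : Matrix m m R}
    (hpa : p * a + q * c = 1) (hpb : p * b + q * d = 0) (hcp : c * p + d * r = 0)
    (hcq : c * q + d * s = 1) (hde : d * e = 1) :
    IsUnit p ∧ e = s - r * p⁻¹ * q := by
  have hed : e * d = 1 := mul_eq_one_comm.1 hde
  have hq : q = -(p * b * e) := by
    have := congrArg (· * e) (eq_neg_of_add_eq_zero_right hpb)
    simpa [Matrix.mul_assoc, hde] using this
  have hr : r = -(e * (c * p)) := by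
    have := congrArg (e * ·) (eq_neg_of_add_eq_zero_right hcp)
    simpa [← Matrix.mul_assoc, hed] using this
  have hp : p * (a - b * e * c) = 1 := by
    rw [← hpa, hq]
    simp [Matrix.mul_add, Matrix.mul_assoc, sub_eq_add_neg]
  have hu : IsUnit p := .of_mul_eq_one _ hp
  refine ⟨hu, ?_⟩
  have hpp : p * p⁻¹ = 1 := Matrix.mul_nonsing_inv _ ((Matrix.isUnit_iff_isUnit_det _).1 hu)
  have hrp : r * p⁻¹ = -(e * c) := by
    rw [hr, Matrix.neg_mul, Matrix.mul_assoc, Matrix.mul_assoc, hpp, Matrix.mul_one]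
  rw [hrp, Matrix.neg_mul, Matrix.mul_assoc, eq_sub_of_add_eq hcq, Matrix.mul_sub,
    ← Matrix.mul_assoc, hed]
  simp

theorem MsubAvoid_compl {n : ℕ} (G : Matrix (Fin n) (Fin n) ℤ) (A : Finset (Fin n)) :
    MsubAvoid G A Aᶜ Aᶜ =
      (Matrix.of (mSer (deleteLinks G A))).submatrix Subtype.val Subtype.val := by
  ext i j t
  simp [MsubAvoid, mAvoid, mSer,
    walkCountAvoid_eq G (Finset.mem_compl.1 i.2) (Finset.mem_compl.1 j.2)]

theorem oneSubX_mul_MsubAvoid {n : ℕ} {G : Matrix (Fin n) (Fin n) ℤ}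
    (hG : ∀ i j, G i j = 0 ∨ G i j = 1) (A : Finset (Fin n)) :
    (oneSubX G).submatrix Subtype.val Subtype.val * MsubAvoid G A Aᶜ Aᶜ = 1 := by
  have hH : ∀ i j, deleteLinks G A i j = 0 ∨ deleteLinks G A i j = 1 := fun i j => by
    by_cases h : i ∈ A ∨ j ∈ A
    · simp [deleteLinks, h]
    · simpa [deleteLinks, h] using hG i j
  have key := submatrix_mul_eq_add (oneSubX (deleteLinks G A))
    (Matrix.of (mSer (deleteLinks G A))) A (Subtype.val : ↥Aᶜ → Fin n)
    (Subtype.val : ↥Aᶜ → Fin n)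
  rw [oneSubX_mul_mSer hH, Matrix.submatrix_one _ Subtype.val_injective] at key
  have hzero : (oneSubX (deleteLinks G A)).submatrix (Subtype.val : ↥Aᶜ → Fin n)
      (Subtype.val : ↥A → Fin n) = 0 := by
    ext1 i j
    have hij : (i : Fin n) ≠ j := fun h => Finset.mem_compl.1 i.2 (h ▸ j.2)
    simp [oneSubX, deleteLinks, hij]
  have hsame : (oneSubX (deleteLinks G A)).submatrix (Subtype.val : ↥Aᶜ → Fin n)
      (Subtype.val : ↥Aᶜ → Fin n) = (oneSubX G).submatrix Subtype.val Subtype.val := by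
    ext1 i j
    simp [oneSubX, deleteLinks, Finset.mem_compl.1 i.2, Finset.mem_compl.1 j.2]
  rw [hzero, Matrix.zero_mul, zero_add, hsame, ← MsubAvoid_compl] at key
  exact key.symm

theorem stmt6 {n : ℕ} (hn : 0 < n) (G : Matrix (Fin n) (Fin n) ℤ)
    (hG : ∀ i j, G i j = 0 ∨ G i j = 1) (hdiag : ∀ i, G i i = 0)
    (A : Finset (Fin n)) :
    IsUnit (Msub G A A) ∧
    MsubAvoid G A Aᶜ Aᶜ =
      Msub G Aᶜ Aᶜ - Msub G Aᶜ A * (Msub G A A)⁻¹ * Msub G A Aᶜ := by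
  have hXM := oneSubX_mul_mSer hG
  have hMX := mul_eq_one_comm.1 hXM
  have hsub : ∀ B C : Finset (Fin n), Msub G B C =
      (Matrix.of (mSer G)).submatrix Subtype.val Subtype.val := fun _ _ => rfl
  have hdisj : ∀ (i : ↥A) (j : ↥Aᶜ), (i : Fin n) ≠ j := fun i j h =>
    Finset.mem_compl.1 j.2 (h ▸ i.2)
  refine schur_complement_of_inverse
    (a := (oneSubX G).submatrix Subtype.val Subtype.val)
    (b := (oneSubX G).submatrix Subtype.val Subtype.val)
    (c := (oneSubX G).submatrix Subtype.val Subtype.val)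
    ?_ ?_ ?_ ?_ (oneSubX_mul_MsubAvoid hG A)
  all_goals simp only [hsub]
  all_goals rw [← submatrix_mul_eq_add]
  · rw [hMX, Matrix.submatrix_one _ Subtype.val_injective]
  · rw [hMX]
    ext1 i j
    simp [hdisj i j]
  · rw [hXM]
    ext1 i j
    simp [(hdisj j i).symm]
  · rw [hXM, Matrix.submatrix_one _ Subtype.val_injective]
end
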